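/- arXiv:math/9901155 — 4 statements merged into one kernel-verified Lean document; each statement's English description precedes it below -/
import Mathlib

section
/- Let A be a discrete valuation ring with fraction field K, let L/K be a finite separable field extension, let B be the integral closure of A in L, and assume B is finite and free as an A-module. Let c ∈ L be a generator of the codifferent of B over A, i.e. B·c = {x ∈ L : Tr_{L/K}(x·b) ∈ A for all b ∈ B}. Then the map sending x ∈ B to the function y ↦ Tr_{L/K}(x·y·c) is well defined (all its values lie in A) and is an isomorphism of B-modules from B onto Hom_A(B, A), where B acts on Hom_A(B, A) by (b·f)(y) = f(b·y). -/
/-- Equation (4) in the proof of Proposition 3.1.1: if `A` is a DVR with fraction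
field `K`, `L/K` a finite separable extension, `B` the integral closure of `A` in `L`
(assumed finite and free as an `A`-module), and `c ∈ L` generates the codifferent of
`B` over `A`, then `x ↦ (y ↦ Tr_{L/K}(x·y·c))` is well defined (its values lie in `A`)
and is an isomorphism of `B`-modules `B ≃ Hom_A(B, A)`, where `B` acts on
`Hom_A(B, A)` through the domain. -/
theorem stmt0
    (A K L : Type*) [CommRing A] [IsDomain A] [IsDiscreteValuationRing A]
    [Field K] [Algebra A K] [IsFractionRing A K]
    [Field L] [Algebra K L] [Algebra A L] [IsScalarTower A K L]
    [FiniteDimensional K L] [Algebra.IsSeparable K L]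
    [Module.Finite A (integralClosure A L)] [Module.Free A (integralClosure A L)]
    (c : L)
    (hc : ∀ x : L,
      (∀ b ∈ integralClosure A L, ∃ a : A, algebraMap A K a = Algebra.trace K L (x * b)) ↔
        ∃ b ∈ integralClosure A L, x = b * c) :
    ∃ e : (integralClosure A L) ≃ₗ[A] ((integralClosure A L) →ₗ[A] A),
      (∀ x y : integralClosure A L,
        algebraMap A K (e x y) = Algebra.trace K L ((x : L) * (y : L) * c)) ∧
      (∀ b x y : integralClosure A L, e (b * x) y = e x (b * y)) := by
  classical
  have hloc : IsLocalization (Algebra.algebraMapSubmonoid (integralClosure A L)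
      (nonZeroDivisors A)) L := IsIntegralClosure.isLocalization A K L (integralClosure A L)
  let β := Module.Free.chooseBasis A (integralClosure A L)
  let B' := β.localizationLocalization K (nonZeroDivisors A) L
  have hB' : ∀ i, B' i = (β i : L) := fun i =>
    Module.Basis.localizationLocalization_apply K (nonZeroDivisors A) L β i
  have hinj : Function.Injective (algebraMap A K) := IsFractionRing.injective A K
  have htrs : ∀ (a : A) (x : L), Algebra.trace K L (a • x) =
      algebraMap A K a * Algebra.trace K L x := by
    intro a x
    rw [← algebraMap_smul K a x, map_smul, smul_eq_mul]
  have hc0 : c ≠ 0 := by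
    obtain ⟨b, -, hb⟩ := (hc 1).1 (by
      intro b hb
      have h1 : IsIntegral A (Algebra.trace K L (1 * b)) := by
        rw [one_mul]
        exact Algebra.isIntegral_trace hb
      exact IsIntegrallyClosed.isIntegral_iff.1 h1)
    rintro rfl
    simp at hb
  have hex : ∀ x y : integralClosure A L, ∃ a : A,
      algebraMap A K a = Algebra.trace K L ((x : L) * (y : L) * c) := by
    intro x y
    obtain ⟨a, ha⟩ := (hc ((x : L) * c)).2 ⟨x, x.2, rfl⟩ y y.2
    exact ⟨a, by rw [ha]; congr 1; ring⟩
  choose g hg using hex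
  let φ : (integralClosure A L) →ₗ[A] ((integralClosure A L) →ₗ[A] A) :=
    LinearMap.mk₂ A g
      (fun x x' y => hinj (by
        rw [map_add, hg, hg, hg, ← map_add]; congr 1; push_cast; ring))
      (fun a x y => hinj (by
        rw [smul_eq_mul, map_mul, hg, hg, ← htrs]; congr 1; simp))
      (fun x y y' => hinj (by
        rw [map_add, hg, hg, hg, ← map_add]; congr 1; push_cast; ring))
      (fun a x y => hinj (by
        rw [smul_eq_mul, map_mul, hg, hg, ← htrs]; congr 1; simp))
  have hφ : ∀ x y, φ x y = g x y := fun x y => rfl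
  have hnd := traceForm_nondegenerate K L
  have hφi : Function.Injective φ := by
    rw [injective_iff_map_eq_zero]
    intro x hx
    have h0 : Algebra.traceForm K L ((x : L) * c) = 0 := by
      apply B'.ext
      intro i
      rw [hB', Algebra.traceForm_apply, LinearMap.zero_apply]
      have := hg x (β i)
      rw [← hφ, hx, LinearMap.zero_apply, map_zero] at this
      rw [this]; congr 1; ring
    have h1 : (x : L) * c = 0 := hnd.1 _ (fun y => by rw [h0]; rfl)
    exact Subtype.ext ((mul_eq_zero.1 h1).resolve_right hc0)
  have hφs : Function.Surjective φ := by
    intro f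
    let F : L →ₗ[K] K := B'.constr K (fun i => algebraMap A K (f (β i)))
    have hF : ∀ y : integralClosure A L, F y = algebraMap A K (f y) := by
      have : (F.restrictScalars A).comp (integralClosure A L).val.toLinearMap =
          (Algebra.linearMap A K).comp f := by
        apply β.ext
        intro i
        simp only [LinearMap.comp_apply, AlgHom.toLinearMap_apply, Subalgebra.coe_val,
          LinearMap.restrictScalars_apply, Algebra.linearMap_apply]
        rw [← hB' i]
        exact B'.constr_basis K _ i
      intro y
      exact LinearMap.congr_fun this y
    let z : L := (LinearMap.BilinForm.toDual (Algebra.traceForm K L) hnd).symm F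
    have hz : ∀ y, Algebra.trace K L (z * y) = F y := fun y =>
      LinearMap.BilinForm.apply_toDual_symm_apply (hB := hnd) F y
    obtain ⟨b, hb, hzb⟩ := (hc z).1 (fun y hy => ⟨f ⟨y, hy⟩, by rw [hz, ← hF]⟩)
    refine ⟨⟨b, hb⟩, LinearMap.ext fun y => hinj ?_⟩
    rw [hφ, hg, ← hF, ← hz, hzb]
    congr 1
    ring
  refine ⟨LinearEquiv.ofBijective φ ⟨hφi, hφs⟩, fun x y => hg x y, fun b x y => hinj ?_⟩
  change algebraMap A K (g (b * x) y) = algebraMap A K (g x (b * y))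
  rw [hg, hg]
  congr 1
  push_cast
  ring
end

section
/- Let A be a discrete valuation ring with fraction field K, let L/K be a finite separable field extension, let B be the integral closure of A in L, assume B is finite and free as an A-module, and let c ∈ L be a generator of the codifferent of B over A, i.e. B·c = {x ∈ L : Tr_{L/K}(x·b) ∈ A for all b ∈ B}. Then for every B-module T, the map sending a B-linear map g : T → B to the A-linear map t ↦ Tr_{L/K}(g(t)·c) is an isomorphism of B-modules Hom_B(T, B) ≅ Hom_A(T, A), where B acts on Hom_A(T, A) by (b·f)(t) = f(b·t). -/
set_option synthInstance.maxHeartbeats 800000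

open nonZeroDivisors in
theorem exists_trace_rep
    (A K L : Type*) [CommRing A] [IsDomain A] [IsDiscreteValuationRing A]
    [Field K] [Algebra A K] [IsFractionRing A K]
    [Field L] [Algebra K L] [Algebra A L] [IsScalarTower A K L]
    [FiniteDimensional K L] [Algebra.IsSeparable K L]
    [Module.Finite A (integralClosure A L)] [Module.Free A (integralClosure A L)]
    (φ : integralClosure A L →ₗ[A] A) :
    ∃ x : L, ∀ b : integralClosure A L,
      algebraMap A K (φ b) = Algebra.trace K L (x * b) := by
  have hloc : IsLocalization (Algebra.algebraMapSubmonoid (integralClosure A L) A⁰) L :=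
    IsIntegralClosure.isLocalization A K L (integralClosure A L)
  let bs := Module.Free.chooseBasis A (integralClosure A L)
  let bL := bs.localizationLocalization K A⁰ L
  let ψ : L →ₗ[K] K := bL.constr K (fun i => algebraMap A K (φ (bs i)))
  have hψ : ∀ b : integralClosure A L, ψ (b : L) = algebraMap A K (φ b) := by
    have h : (ψ.restrictScalars A) ∘ₗ ((integralClosure A L).val.toLinearMap) =
        (Algebra.linearMap A K) ∘ₗ φ := by
      apply bs.ext
      intro i
      have h1 : ((bs i : integralClosure A L) : L) = bL i := by
        rw [Module.Basis.localizationLocalization_apply]; rfl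
      simp only [LinearMap.comp_apply, LinearMap.restrictScalars_apply,
        AlgHom.toLinearMap_apply, Subalgebra.coe_val, Algebra.linearMap_apply]
      rw [h1, Module.Basis.constr_basis]
    intro b
    exact LinearMap.congr_fun h b
  have nd := traceForm_nondegenerate K L
  refine ⟨((Algebra.traceForm K L).toDual nd).symm ψ, fun b => ?_⟩
  rw [← hψ, ← Algebra.traceForm_apply, LinearMap.BilinForm.apply_toDual_symm_apply]

open nonZeroDivisors in
theorem eq_zero_of_trace
    (A K L : Type*) [CommRing A] [IsDomain A]
    [Field K] [Algebra A K] [IsFractionRing A K]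
    [Field L] [Algebra K L] [Algebra A L] [IsScalarTower A K L]
    [FiniteDimensional K L] [Algebra.IsSeparable K L]
    (x : L) (hx : ∀ b : integralClosure A L, Algebra.trace K L (x * b) = 0) : x = 0 := by
  have nd := traceForm_nondegenerate K L
  refine nd.1 x fun y => ?_
  have : Algebra.IsAlgebraic A L := by
    have : Algebra.IsAlgebraic K L := inferInstance
    exact (IsFractionRing.comap_isAlgebraic_iff (A := A) (K := K) (C := L)).2 this
  obtain ⟨a, ha, hy⟩ := (Algebra.IsAlgebraic.isAlgebraic (R := A) y).exists_integral_multiple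
  have h := hx ⟨a • y, hy⟩
  simp only [mul_smul_comm] at h
  rw [← algebraMap_smul K a (x * y), map_smul, smul_eq_zero] at h
  rw [Algebra.traceForm_apply]
  refine h.resolve_left fun h0 => ha ?_
  exact (map_eq_zero_iff _ (IsFractionRing.injective A K)).1 h0

/-- The isomorphism `Hom_{O_F}(T, O_F) ≅ Hom_{O_K}(T, O_K)` in the proof of
Proposition 3.1.1: if `A` is a DVR with fraction field `K`, `L/K` a finite separable
extension, `B` the integral closure of `A` in `L` (assumed finite and free as an
`A`-module), and `c ∈ L` generates the codifferent of `B` over `A`, then for every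
`B`-module `T` the map `g ↦ (t ↦ Tr_{L/K}(g(t)·c))` is a well-defined isomorphism of
`B`-modules `Hom_B(T, B) ≅ Hom_A(T, A)`, where `B` acts on `Hom_A(T, A)` through
the domain. -/
theorem stmt1
    (A K L : Type*) [CommRing A] [IsDomain A] [IsDiscreteValuationRing A]
    [Field K] [Algebra A K] [IsFractionRing A K]
    [Field L] [Algebra K L] [Algebra A L] [IsScalarTower A K L]
    [FiniteDimensional K L] [Algebra.IsSeparable K L]
    [Module.Finite A (integralClosure A L)] [Module.Free A (integralClosure A L)]
    (c : L)
    (hc : ∀ x : L,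
      (∀ b ∈ integralClosure A L, ∃ a : A, algebraMap A K a = Algebra.trace K L (x * b)) ↔
        ∃ b ∈ integralClosure A L, x = b * c)
    (T : Type*) [AddCommGroup T] [Module (integralClosure A L) T]
    [Module A T] [IsScalarTower A (integralClosure A L) T] :
    ∃ e : (T →ₗ[(integralClosure A L)] (integralClosure A L)) ≃ₗ[A] (T →ₗ[A] A),
      (∀ (g : T →ₗ[(integralClosure A L)] (integralClosure A L)) (t : T),
        algebraMap A K (e g t) = Algebra.trace K L ((g t : L) * c)) ∧
      (∀ (b : integralClosure A L) (g : T →ₗ[(integralClosure A L)] (integralClosure A L))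
        (t : T), e (b • g) t = e g (b • t)) := by
  have inj := IsFractionRing.injective A K
  have hc0 : c ≠ 0 := by
    rintro rfl
    obtain ⟨b, -, hb⟩ := (hc 1).1 (fun b hb => by
      rw [one_mul]
      exact IsIntegrallyClosed.isIntegral_iff.1 (Algebra.isIntegral_trace (L := K) hb))
    simp at hb
  have hθ : ∀ b : integralClosure A L, ∃ a : A,
      algebraMap A K a = Algebra.trace K L ((b : L) * c) := fun b => by
    obtain ⟨a, ha⟩ := (hc ((b : L) * c)).2 ⟨b, b.2, rfl⟩ 1 (one_mem _)
    exact ⟨a, by rw [ha, mul_one]⟩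
  choose θ₀ hθ₀ using hθ
  let θ : integralClosure A L →ₗ[A] A :=
    { toFun := θ₀
      map_add' := fun x y => inj (by
        rw [map_add, hθ₀, hθ₀, hθ₀, ← map_add, ← add_mul]; rfl)
      map_smul' := fun a x => inj (by
        rw [RingHom.id_apply, smul_eq_mul, map_mul, hθ₀, hθ₀, ← smul_eq_mul (algebraMap A K a), ← map_smul,
          algebraMap_smul, ← smul_mul_assoc]; rfl) }
  have hθ : ∀ b, algebraMap A K (θ b) = Algebra.trace K L ((b : L) * c) := hθ₀
  have uniq : ∀ x y : integralClosure A L, (∀ b, θ (b * x) = θ (b * y)) → x = y := by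
    intro x y h
    have h0 : ((x : L) - y) * c = 0 := by
      apply eq_zero_of_trace A K L
      intro b
      have := congrArg (algebraMap A K) (h b)
      rw [hθ, hθ, ← sub_eq_zero, ← map_sub] at this
      rw [← this]
      congr 1
      push_cast
      ring
    exact Subtype.ext (sub_eq_zero.1 ((mul_eq_zero.1 h0).resolve_right hc0))
  have ex : ∀ φ : integralClosure A L →ₗ[A] A, ∃ x, ∀ b, θ (b * x) = φ b := by
    intro φ
    obtain ⟨x, hx⟩ := exists_trace_rep A K L φ
    obtain ⟨β, hβ, rfl⟩ := (hc x).1 (fun b hb => ⟨φ ⟨b, hb⟩, hx ⟨b, hb⟩⟩)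
    refine ⟨⟨β, hβ⟩, fun b => inj ?_⟩
    rw [hθ, hx]
    congr 1
    push_cast
    ring
  let E : (T →ₗ[(integralClosure A L)] (integralClosure A L)) →ₗ[A] (T →ₗ[A] A) :=
    { toFun := fun g => θ ∘ₗ g.restrictScalars A
      map_add' := fun g h => by ext t; simp
      map_smul' := fun a g => by ext t; simp }
  have hE : ∀ g t, E g t = θ (g t) := fun _ _ => rfl
  have bij : Function.Bijective E := by
    constructor
    · intro g h hgh
      ext1 t
      apply uniq
      intro b
      have := LinearMap.congr_fun hgh (b • t)
      rwa [hE, hE, g.map_smul, h.map_smul] at this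
    · intro f
      have : ∀ t : T, ∃ x, ∀ b : integralClosure A L, θ (b * x) = f (b • t) := fun t =>
        ex (f ∘ₗ (LinearMap.toSpanSingleton (integralClosure A L) T t).restrictScalars A)
      choose g hg using this
      refine ⟨{ toFun := g, map_add' := ?_, map_smul' := ?_ }, ?_⟩
      · intro s t
        apply uniq
        intro b
        rw [mul_add, map_add, hg, hg, hg, smul_add, map_add]
      · intro r t
        apply uniq
        intro b
        rw [RingHom.id_apply, smul_eq_mul, ← mul_assoc, hg, hg, mul_smul]
      · ext t
        rw [hE]
        have := hg t 1
        rwa [one_mul, one_smul] at this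
  refine ⟨LinearEquiv.ofBijective E bij, fun g t => ?_, fun b g t => ?_⟩
  · rw [LinearEquiv.ofBijective_apply, hE, hθ]
  · rw [LinearEquiv.ofBijective_apply, LinearEquiv.ofBijective_apply, hE, hE, map_smul]
    rfl
end

section
/- Let K be a field, let q ≥ 2 be an integer, and let φ ∈ K⟦z⟧ be a formal power series with constant coefficient 0, coefficient of z equal to 1, and whose coefficient of z^n vanishes for every n not congruent to 1 modulo q − 1. Let β ∈ K be nonzero, so that the power series β − φ is invertible in K⟦z⟧. Then for every integer k with 1 ≤ k ≤ q − 1, the coefficient of z^{k−1} in the product φ′(z)·(β − φ(z))^{−1} equals β^{−k}, where φ′ denotes the formal derivative of φ. -/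
/-- The power-series computation in the proof of Proposition 4.2.4: let `K` be a
field, `q ≥ 2`, and `φ ∈ K⟦z⟧` with `φ(0) = 0`, `φ'(0) = 1`, and all coefficients
in degrees not congruent to `1` modulo `q − 1` equal to zero.  If `β ∈ K` is
nonzero, then for `1 ≤ k ≤ q − 1` the coefficient of `z^(k−1)` in
`φ'(z)·(β − φ(z))⁻¹` equals `β⁻ᵏ`. -/
theorem stmt6
    (K : Type*) [Field K] (q : ℕ) (hq : 2 ≤ q)
    (φ : PowerSeries K)
    (h0 : PowerSeries.coeff 0 φ = 0)
    (h1 : PowerSeries.coeff 1 φ = 1)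
    (hcong : ∀ n : ℕ, ¬ n ≡ 1 [MOD (q - 1)] → PowerSeries.coeff n φ = 0)
    (β : K) (hβ : β ≠ 0)
    (k : ℕ) (hk1 : 1 ≤ k) (hk2 : k ≤ q - 1) :
    PowerSeries.coeff (k - 1)
        (PowerSeries.derivative K φ * (PowerSeries.C β - φ)⁻¹) = β⁻¹ ^ k := by
  have hsmall : ∀ n : ℕ, n ≤ q - 1 → n ≠ 1 → PowerSeries.coeff n φ = 0 := by
    intro n hn hn1
    rcases Nat.eq_zero_or_pos n with rfl | hpos
    · exact h0
    · apply hcong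
      intro h
      have hd := (Nat.modEq_iff_dvd' (by omega : 1 ≤ n)).1 h.symm
      have := Nat.le_of_dvd (by omega) hd
      omega
  have hc : PowerSeries.constantCoeff (PowerSeries.C β - φ) ≠ 0 := by
    have h0' : PowerSeries.constantCoeff φ = 0 := by simpa using h0
    simpa [h0'] using hβ
  set G := PowerSeries.derivative K φ * (PowerSeries.C β - φ)⁻¹ with hG
  have hmul : PowerSeries.derivative K φ = PowerSeries.C β * G - G * φ := by
    have : PowerSeries.derivative K φ = G * (PowerSeries.C β - φ) := by
      rw [hG, mul_assoc, PowerSeries.inv_mul_cancel _ hc, mul_one]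
    rw [this]; ring
  clear_value G
  have key : ∀ n : ℕ, n + 1 ≤ q - 1 → PowerSeries.coeff n G = β⁻¹ ^ (n + 1) := by
    intro n
    induction n with
    | zero =>
      intro _
      have h := congrArg (PowerSeries.coeff 0) hmul
      have hs : PowerSeries.coeff 0 (G * φ) = 0 := by
        rw [PowerSeries.coeff_zero_eq_constantCoeff_apply] at h0 ⊢
        rw [map_mul, h0, mul_zero]
      rw [PowerSeries.coeff_derivative, map_sub, PowerSeries.coeff_C_mul, hs, zero_add, h1] at h
      rw [zero_add, pow_one, ← one_mul β⁻¹, eq_mul_inv_iff_mul_eq₀ hβ]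
      push_cast at h
      linear_combination -h
    | succ n ih =>
      intro hn
      have h := congrArg (PowerSeries.coeff (n + 1)) hmul
      have hs : PowerSeries.coeff (n + 1) (G * φ) = PowerSeries.coeff n G := by
        rw [PowerSeries.coeff_mul, Finset.sum_eq_single (n, 1)]
        · simp [h1]
        · rintro ⟨i, j⟩ hij hne
          rw [Finset.HasAntidiagonal.mem_antidiagonal] at hij
          simp only at hij
          rw [hsmall j (by omega), mul_zero]
          rintro rfl
          apply hne
          ext <;> simp <;> omega
        · intro hh
          exact (hh (by rw [Finset.HasAntidiagonal.mem_antidiagonal])).elim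
      rw [PowerSeries.coeff_derivative, map_sub, PowerSeries.coeff_C_mul, hs,
        hsmall (n + 1 + 1) (by omega) (by omega), ih (by omega), zero_mul] at h
      rw [pow_succ β⁻¹ (n + 1), eq_mul_inv_iff_mul_eq₀ hβ]
      linear_combination -h
  have := key (k - 1) (by omega)
  rwa [Nat.sub_add_cancel hk1] at this
end

section
/- Let R be a commutative ring, S a nontrivial commutative local ring, and ψ : R → S a surjective ring homomorphism; regard S as an R-module via ψ. Let U be a free R-module of rank 2 and let l : U → S be a surjective R-linear map. Then there exist w₁, w₂ ∈ U forming an R-basis of U such that l(w₂) = 0, l(w₁) is a unit of S, and the kernel of l is exactly the set {a·w₁ + b·w₂ : a ∈ ker ψ, b ∈ R}. -/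
theorem stmt8_aux
    (R S : Type*) [CommRing R] [CommRing S]
    (ψ : R →+* S) (hψ : Function.Surjective ψ)
    (U : Type*) [AddCommGroup U] [Module R U]
    (bU : Module.Basis (Fin 2) R U)
    (l : U →+ S) (hlin : ∀ (r : R) (u : U), l (r • u) = ψ r * l u)
    (hu : IsUnit (l (bU 0))) :
    ∃ w₁ w₂ : U,
      (∃ b : Module.Basis (Fin 2) R U, b 0 = w₁ ∧ b 1 = w₂) ∧
      l w₂ = 0 ∧ IsUnit (l w₁) ∧
      (∀ u : U, l u = 0 ↔ ∃ a b : R, ψ a = 0 ∧ u = a • w₁ + b • w₂) := by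
  obtain ⟨v, hv⟩ := hu.exists_left_inv
  obtain ⟨r, hr⟩ := hψ (l (bU 1) * v)
  have h2 : l (bU 1 - r • bU 0) = 0 := by
    rw [map_sub, hlin, hr, mul_assoc, hv, mul_one, sub_self]
  have hli : LinearIndependent R ![bU 0, bU 1 - r • bU 0] := by
    rw [LinearIndependent.pair_iff]
    intro s t h
    have h0 := bU.linearIndependent
    rw [Fintype.linearIndependent_iff] at h0
    have h1 := h0 ![s - t * r, t] (by
      rw [Fin.sum_univ_two, ← h]
      simp only [Matrix.cons_val_zero, Matrix.cons_val_one]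
      module)
    have ht : t = 0 := by simpa using h1 1
    have hs : s - t * r = 0 := by simpa using h1 0
    exact ⟨by simpa [ht] using hs, ht⟩
  have hrep : ∀ u : U, ∃ a b : R, u = a • bU 0 + b • (bU 1 - r • bU 0) := by
    intro u
    refine ⟨bU.repr u 0 + bU.repr u 1 * r, bU.repr u 1, ?_⟩
    have := bU.sum_repr u
    rw [Fin.sum_univ_two] at this
    nth_rewrite 1 [← this]
    module
  have hsp : ⊤ ≤ Submodule.span R (Set.range ![bU 0, bU 1 - r • bU 0]) := by
    intro u _
    obtain ⟨a, b, h⟩ := hrep u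
    rw [Matrix.range_cons, Matrix.range_cons, Matrix.range_empty, Set.union_empty,
      Set.singleton_union, Submodule.mem_span_pair]
    exact ⟨a, b, h.symm⟩
  refine ⟨bU 0, bU 1 - r • bU 0, ⟨Module.Basis.mk hli hsp, by simp, by simp⟩, h2, hu, ?_⟩
  intro u
  constructor
  · intro h
    obtain ⟨a, b, hab⟩ := hrep u
    refine ⟨a, b, ?_, hab⟩
    rw [hab, map_add, hlin, hlin, h2, mul_zero, add_zero] at h
    exact (hu.mul_left_eq_zero).1 h
  · rintro ⟨a, b, ha, rfl⟩
    rw [map_add, hlin, hlin, h2, ha, mul_zero, zero_mul, add_zero]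

/-- The module-theoretic core of Lemma 4.2.5: let `ψ : R → S` be a surjective ring
homomorphism onto a nontrivial commutative local ring, `U` a free `R`-module of
rank `2`, and `l : U → S` a surjective `R`-linear map (where `R` acts on `S` via
`ψ`).  Then there is an `R`-basis `w₁, w₂` of `U` with `l(w₂) = 0`, `l(w₁)` a unit,
and `ker l = {a·w₁ + b·w₂ : a ∈ ker ψ, b ∈ R}`. -/
theorem stmt8
    (R S : Type*) [CommRing R] [CommRing S] [Nontrivial S] [IsLocalRing S]
    (ψ : R →+* S) (hψ : Function.Surjective ψ)
    (U : Type*) [AddCommGroup U] [Module R U]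
    (bU : Module.Basis (Fin 2) R U)
    (l : U →+ S) (hlin : ∀ (r : R) (u : U), l (r • u) = ψ r * l u)
    (hsurj : Function.Surjective l) :
    ∃ w₁ w₂ : U,
      (∃ b : Module.Basis (Fin 2) R U, b 0 = w₁ ∧ b 1 = w₂) ∧
      l w₂ = 0 ∧ IsUnit (l w₁) ∧
      (∀ u : U, l u = 0 ↔ ∃ a b : R, ψ a = 0 ∧ u = a • w₁ + b • w₂) := by
  obtain ⟨u, hu⟩ := hsurj 1
  have h := bU.sum_repr u
  rw [Fin.sum_univ_two] at h
  rw [← h, map_add, hlin, hlin] at hu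
  rcases IsLocalRing.isUnit_or_isUnit_of_add_one hu with h | h
  · exact stmt8_aux R S ψ hψ U bU l hlin (isUnit_of_mul_isUnit_right h)
  · refine stmt8_aux R S ψ hψ U (bU.reindex (Equiv.swap 0 1)) l hlin ?_
    simpa using isUnit_of_mul_isUnit_right h
end
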